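/- The group Γ = PSL₂(R) is generated by its side-pairing transformations, i.e. by the set of all γ ∈ Γ, γ ≠ 1, such that F ∩ γ⁻¹(F) has Hausdorff dimension 3 (these sets are semi-algebraic, for which Hausdorff dimension agrees with semi-algebraic dimension). -/

import Mathlib

noncomputable section

open scoped Classical
open MeasureTheory

namespace Hilbert

/-- `k₀ = 2` if `k ≡ 1 (mod 4)` and `k₀ = 1` otherwise. -/
def k0 (k : ℕ) : ℝ := if k % 4 = 1 then 2 else 1

/-- `ω = (1 + √k)/k₀`. -/
def omg (k : ℕ) : ℝ := (1 + Real.sqrt k) / k0 k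

/-- `ω' = (1 - √k)/k₀`, the algebraic conjugate of `ω`. -/
def omg' (k : ℕ) : ℝ := (1 - Real.sqrt k) / k0 k

/-- The ring `R = ℤ[ω]`, realized inside `ℝ × ℝ` via the pair of real embeddings
`α ↦ (α, α')` of `K = ℚ(√k)`. -/
def R (k : ℕ) : Subring (ℝ × ℝ) := Subring.closure {(omg k, omg' k)}

/-- The ambient space `ℝ⁴`, with coordinates `(x₁, x₂, y₁, y₂)`. -/
abbrev Pt : Type := ℝ × ℝ × ℝ × ℝ

def x1 (p : Pt) : ℝ := p.1
def x2 (p : Pt) : ℝ := p.2.1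
def y1 (p : Pt) : ℝ := p.2.2.1
def y2 (p : Pt) : ℝ := p.2.2.2

/-- `H² × H²`, identified with an open subset of `ℝ⁴`. -/
def HH : Set Pt := {p | 0 < y1 p ∧ 0 < y2 p}

/-- The coordinate `s₁`, determined by `x₁ = s₁ + s₂ ω`, `x₂ = s₁ + s₂ ω'`. -/
def s1 (k : ℕ) (p : Pt) : ℝ := (omg' k * x1 p - omg k * x2 p) / (omg' k - omg k)

/-- The coordinate `s₂`. -/
def s2 (k : ℕ) (p : Pt) : ℝ := (x1 p - x2 p) / (omg k - omg' k)

/-- The ratio `r = y₁/y₂`. -/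
def rr (p : Pt) : ℝ := y1 p / y2 p

/-- The height `h = y₁ y₂`. -/
def hh (p : Pt) : ℝ := y1 p * y2 p

/-- `‖cZ+d‖ = ((cx₁+d)² + c²y₁²)((c'x₂+d')² + c'²y₂²)`, where `c = (c, c')`, `d = (d, d')`
are given by their two real embeddings. -/
def HNorm (c d : ℝ × ℝ) (p : Pt) : ℝ :=
  ((c.1 * x1 p + d.1) ^ 2 + c.1 ^ 2 * y1 p ^ 2) *
    ((c.2 * x2 p + d.2) ^ 2 + c.2 ^ 2 * y2 p ^ 2)

/-- `S = {(c,d) ∈ R² : cR + dR = R}`. -/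
def Spairs (k : ℕ) : Set (R k × R k) := {cd | Ideal.span {cd.1, cd.2} = ⊤}

/-- `V_{c,d}^≥ = {Z ∈ H²×H² : ‖cZ+d‖ ≥ 1}`. -/
def Vge (k : ℕ) (cd : R k × R k) : Set Pt :=
  {p ∈ HH | 1 ≤ HNorm (cd.1 : ℝ × ℝ) (cd.2 : ℝ × ℝ) p}

/-- `V_{c,d}^≤ = {Z ∈ H²×H² : ‖cZ+d‖ ≤ 1}`. -/
def Vle (k : ℕ) (cd : R k × R k) : Set Pt :=
  {p ∈ HH | HNorm (cd.1 : ℝ × ℝ) (cd.2 : ℝ × ℝ) p ≤ 1}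

/-- `V_{c,d} = {Z ∈ H²×H² : ‖cZ+d‖ = 1}`. -/
def Veq (k : ℕ) (cd : R k × R k) : Set Pt :=
  {p ∈ HH | HNorm (cd.1 : ℝ × ℝ) (cd.2 : ℝ × ℝ) p = 1}

/-- `F₀ = {Z ∈ H²×H² : ‖cZ+d‖ ≥ 1 for all (c,d) ∈ S}`. -/
def F0 (k : ℕ) : Set Pt :=
  {p ∈ HH | ∀ cd ∈ Spairs k, 1 ≤ HNorm (cd.1 : ℝ × ℝ) (cd.2 : ℝ × ℝ) p}

/-- `F_∞ = {(s₁,s₂,r,h) : |s₁| ≤ 1/2, |s₂| ≤ 1/2, ε₀⁻² ≤ r ≤ ε₀²}`, where `ε` stands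
for the fundamental unit `ε₀`. -/
def FInf (k : ℕ) (ε : ℝ) : Set Pt :=
  {p ∈ HH | |s1 k p| ≤ 1 / 2 ∧ |s2 k p| ≤ 1 / 2 ∧ (ε ^ 2)⁻¹ ≤ rr p ∧ rr p ≤ ε ^ 2}

/-- `F = F_∞ ∩ F₀`. -/
def F (k : ℕ) (ε : ℝ) : Set Pt := FInf k ε ∩ F0 k

/-- `SL₂(R)`. -/
abbrev SL (k : ℕ) := Matrix.SpecialLinearGroup (Fin 2) (R k)

/-- Möbius action on the upper half-plane: image of `x + y i` under `(a b; c d)`. -/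
def moeb (a b c d x y : ℝ) : ℝ × ℝ :=
  (((a * x + b) * (c * x + d) + a * c * y ^ 2) / ((c * x + d) ^ 2 + c ^ 2 * y ^ 2),
    y / ((c * x + d) ^ 2 + c ^ 2 * y ^ 2))

/-- The action of `γ ∈ SL₂(R)` on `H²×H²`: `γ` acts on the first factor through the first
embedding and through the conjugate matrix `γ'` (second embedding) on the second factor.
This descends to the Hilbert modular group `PSL₂(R)`. -/
def act (k : ℕ) (g : SL k) (p : Pt) : Pt :=
  ((moeb (g.1 0 0 : ℝ × ℝ).1 (g.1 0 1 : ℝ × ℝ).1 (g.1 1 0 : ℝ × ℝ).1 (g.1 1 1 : ℝ × ℝ).1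
      (x1 p) (y1 p)).1,
   (moeb (g.1 0 0 : ℝ × ℝ).2 (g.1 0 1 : ℝ × ℝ).2 (g.1 1 0 : ℝ × ℝ).2 (g.1 1 1 : ℝ × ℝ).2
      (x2 p) (y2 p)).1,
   (moeb (g.1 0 0 : ℝ × ℝ).1 (g.1 0 1 : ℝ × ℝ).1 (g.1 1 0 : ℝ × ℝ).1 (g.1 1 1 : ℝ × ℝ).1
      (x1 p) (y1 p)).2,
   (moeb (g.1 0 0 : ℝ × ℝ).2 (g.1 0 1 : ℝ × ℝ).2 (g.1 1 0 : ℝ × ℝ).2 (g.1 1 1 : ℝ × ℝ).2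
      (x2 p) (y2 p)).2)

/-- The pair of real embeddings of a unit of `R`. -/
def unitVal (k : ℕ) (u : (R k)ˣ) : ℝ × ℝ := ((u : R k) : ℝ × ℝ)

/-- `e` is the fundamental unit of `R`: the smallest unit of `R` greater than `1`
(with respect to the first embedding). -/
def IsFundUnit (k : ℕ) (e : (R k)ˣ) : Prop :=
  1 < (unitVal k e).1 ∧
    ∀ v : (R k)ˣ, 1 < (unitVal k v).1 → (unitVal k e).1 ≤ (unitVal k v).1

/-- The real number `ε₀ > 1`, the fundamental unit under the first embedding. -/
def eps (k : ℕ) (e : (R k)ˣ) : ℝ := (unitVal k e).1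


/-- The norm `N(c) = c c'` of an element of `R` (as a real number). -/
def Nm (k : ℕ) (c : R k) : ℝ := ((c : ℝ × ℝ)).1 * ((c : ℝ × ℝ)).2

/-- A subset `C` of `H²×H²` is hyperbolically bounded if it is bounded in the
Euclidean metric and `y₁, y₂ > ε` on `C` for some `ε > 0`. -/
def HypBounded (C : Set Pt) : Prop :=
  C ⊆ HH ∧ Bornology.IsBounded C ∧ ∃ ε > (0 : ℝ), ∀ p ∈ C, ε < y1 p ∧ ε < y2 p

/-- `V_{C,μ} = {(c,d) ∈ R × R : ‖cZ+d‖ ≤ μ for some Z ∈ C}`. -/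
def VCmu (k : ℕ) (C : Set Pt) (μ : ℝ) : Set (R k × R k) :=
  {cd | ∃ p ∈ C, HNorm (cd.1 : ℝ × ℝ) (cd.2 : ℝ × ℝ) p ≤ μ}

/-- The conditions (8) of Theorem `FiniteSides` on a pair `(c,d) ∈ R²`. -/
def SCond (k : ℕ) (ε : ℝ) (cd : R k × R k) : Prop :=
  cd.1 ≠ 0 ∧ Ideal.span {cd.1, cd.2} = ⊤ ∧
    |Nm k cd.1| ≤ 2 * k / (k0 k) ^ 2 ∧
    |((cd.2 : ℝ × ℝ)).1 / ((cd.1 : ℝ × ℝ)).1| <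
      ε * Real.sqrt (2 * k / (Nm k cd.1 ^ 2 * (k0 k) ^ 2) - (k0 k) ^ 2 / (2 * k)) +
        (1 + omg k) / 2 ∧
    |((cd.2 : ℝ × ℝ)).2 / ((cd.1 : ℝ × ℝ)).2| <
      ε * Real.sqrt (2 * k / (Nm k cd.1 ^ 2 * (k0 k) ^ 2) - (k0 k) ^ 2 / (2 * k)) +
        (1 - omg' k) / 2

/-- `S₁` is a set of representatives, up to multiplication by units of `R`, of the pairs
`(c,d) ∈ R²` satisfying the conditions `SCond`. -/
def IsRepSet (k : ℕ) (ε : ℝ) (S1 : Set (R k × R k)) : Prop :=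
  (∀ cd ∈ S1, SCond k ε cd) ∧
    (∀ cd : R k × R k, SCond k ε cd →
      ∃ ab ∈ S1, ∃ u : (R k)ˣ, cd.1 = (u : R k) * ab.1 ∧ cd.2 = (u : R k) * ab.2) ∧
    (∀ ab ∈ S1, ∀ ab' ∈ S1,
      (∃ u : (R k)ˣ, ab'.1 = (u : R k) * ab.1 ∧ ab'.2 = (u : R k) * ab.2) → ab = ab')

/-- The family `𝒱_∞ = {V_i^± : i = 1,2,3}`. -/
def VfamInf (k : ℕ) (ε : ℝ) : Set (Set Pt) :=
  { {p ∈ HH | s1 k p = 1 / 2}, {p ∈ HH | s1 k p = -(1 / 2)},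
    {p ∈ HH | s2 k p = 1 / 2}, {p ∈ HH | s2 k p = -(1 / 2)},
    {p ∈ HH | rr p = ε ^ 2}, {p ∈ HH | rr p = (ε ^ 2)⁻¹} }

/-- The family `𝒱 = {V_{c,d} : (c,d) ∈ S, c ≠ 0}`. -/
def Vfam (k : ℕ) : Set (Set Pt) :=
  {V | ∃ cd ∈ Spairs k, cd.1 ≠ 0 ∧ V = Veq k cd}

/-- The family `𝓜 = {γ(M) : γ ∈ Γ, M ∈ 𝒱 ∪ 𝒱_∞}`. -/
def Mfam (k : ℕ) (ε : ℝ) : Set (Set Pt) :=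
  {M | ∃ g : SL k, ∃ V ∈ Vfam k ∪ VfamInf k ε, M = act k g '' V}

/-- `ω` as an element of `R`. -/
def omR (k : ℕ) : R k := ⟨(omg k, omg' k), Subring.subset_closure rfl⟩

/-- The side-pairing transformations: `γ ≠ 1` (in `PSL₂(R)`) such that `F ∩ γ⁻¹(F)` has
Hausdorff dimension `3`. -/
def SidePairings (k : ℕ) (ε : ℝ) : Set (SL k) :=
  {g | g ≠ 1 ∧ g.1 ≠ -1 ∧ dimH (F k ε ∩ act k g⁻¹ '' F k ε) = 3}



/-! ### Arithmetic of `R` -/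

lemma k0_pos (k : ℕ) : 0 < k0 k := by unfold k0; split_ifs <;> norm_num

lemma omg_quad (k : ℕ) (hk1 : 1 < k) : ∃ s t : ℤ, omg k + omg' k = s ∧ omg k * omg' k = -t := by
  have hs : Real.sqrt k * Real.sqrt k = k := Real.mul_self_sqrt (by positivity)
  by_cases h : k % 4 = 1
  · refine ⟨1, ((k / 4 : ℕ) : ℤ), ?_, ?_⟩
    · simp only [omg, omg', k0, h, if_true]; push_cast; ring
    · have h2 : (k : ℝ) = 4 * ((k / 4 : ℕ) : ℝ) + 1 := by
        have : k = 4 * (k / 4) + 1 := by omega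
        exact_mod_cast this
      simp only [omg, omg', k0, h, if_true]
      rw [Int.cast_natCast]
      linear_combination (-1/4 : ℝ) * hs - (1/4 : ℝ) * h2
  · refine ⟨2, (k : ℤ) - 1, ?_, ?_⟩
    · simp only [omg, omg', k0, h, if_false]; push_cast; ring
    · simp only [omg, omg', k0, h, if_false]; push_cast; nlinarith

lemma omg_sub_pos (k : ℕ) (hk1 : 1 < k) : 0 < omg k - omg' k := by
  have h0 := k0_pos k
  have : omg k - omg' k = 2 * Real.sqrt k / k0 k := by
    simp only [omg, omg']; field_simp; ring
  rw [this]
  have : 0 < Real.sqrt k := Real.sqrt_pos.2 (by exact_mod_cast (by omega : 0 < k))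
  positivity

lemma omg'_ne (k : ℕ) (hk1 : 1 < k) : omg' k ≠ 0 := by
  have h0 := k0_pos k
  have : 1 < Real.sqrt k := by
    rw [Real.lt_sqrt (by norm_num)]; norm_num; exact hk1
  unfold omg'
  apply div_ne_zero <;> linarith

lemma R_form (k : ℕ) (hk1 : 1 < k) (α : R k) :
    ∃ m n : ℤ, (α : ℝ × ℝ).1 = m + n * omg k ∧ (α : ℝ × ℝ).2 = m + n * omg' k := by
  obtain ⟨s, t, hs, ht⟩ := omg_quad k hk1
  obtain ⟨α, hα⟩ := α
  have q1 : omg k * omg k = s * omg k + t := by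
    have : omg' k = s - omg k := by linarith
    rw [this] at ht; linarith
  have q2 : omg' k * omg' k = s * omg' k + t := by
    have : omg k = s - omg' k := by linarith
    rw [this] at ht; linarith
  simp only
  unfold R at hα
  induction hα using Subring.closure_induction with
  | mem x hx => 
    rw [Set.mem_singleton_iff] at hx; subst hx
    exact ⟨0, 1, by simp, by simp⟩
  | zero => exact ⟨0, 0, by simp, by simp⟩
  | one => exact ⟨1, 0, by simp, by simp⟩
  | add x y _ _ hx hy =>
    obtain ⟨m, n, h1, h2⟩ := hx
    obtain ⟨m', n', h1', h2'⟩ := hy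
    refine ⟨m + m', n + n', ?_, ?_⟩
    · rw [Prod.fst_add, h1, h1']; push_cast; ring
    · rw [Prod.snd_add, h2, h2']; push_cast; ring
  | neg x _ hx =>
    obtain ⟨m, n, h1, h2⟩ := hx
    refine ⟨-m, -n, ?_, ?_⟩
    · rw [Prod.fst_neg, h1]; push_cast; ring
    · rw [Prod.snd_neg, h2]; push_cast; ring
  | mul x y _ _ hx hy =>
    obtain ⟨m, n, h1, h2⟩ := hx
    obtain ⟨m', n', h1', h2'⟩ := hy
    refine ⟨m * m' + n * n' * t, m * n' + n * m' + n * n' * s, ?_, ?_⟩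
    · rw [Prod.fst_mul, h1, h1']; push_cast; linear_combination (n * n' : ℝ) * q1
    · rw [Prod.snd_mul, h2, h2']; push_cast; linear_combination (n * n' : ℝ) * q2

lemma irr_sqrt (k : ℕ) (hk : Squarefree k) (hk1 : 1 < k) : Irrational (Real.sqrt k) := by
  rw [irrational_sqrt_natCast_iff]
  rintro ⟨r, hr⟩
  have := hk r ⟨1, by omega⟩
  rw [Nat.isUnit_iff] at this
  subst this; omega

lemma irr_omg (k : ℕ) (hk : Squarefree k) (hk1 : 1 < k) :
    Irrational (omg k) ∧ Irrational (omg' k) := by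
  have h := irr_sqrt k hk hk1
  have hq : ∃ q : ℚ, q ≠ 0 ∧ k0 k = q := by
    unfold k0; split_ifs
    · exact ⟨2, by norm_num, by norm_num⟩
    · exact ⟨1, by norm_num, by norm_num⟩
  obtain ⟨q, hq0, hq⟩ := hq
  unfold omg omg'
  rw [hq]
  constructor
  · have := (h.ratCast_add 1).div_ratCast hq0
    simpa using this
  · have := (h.ratCast_sub 1).div_ratCast hq0
    simpa using this

lemma int_lin_zero {w : ℝ} (hw : Irrational w) {m n : ℤ} (h : (m : ℝ) + n * w = 0) :
    m = 0 ∧ n = 0 := by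
  have hn : n = 0 := by
    by_contra hn
    apply hw
    refine ⟨-m / n, ?_⟩
    have : (n : ℝ) ≠ 0 := by exact_mod_cast hn
    push_cast
    field_simp
    linarith
  subst hn
  simp at h
  exact ⟨by exact_mod_cast h, rfl⟩

section
variable {k : ℕ}

lemma R_fst_zero (hk : Squarefree k) (hk1 : 1 < k) {α : R k} (h : (α : ℝ × ℝ).1 = 0) : α = 0 := by
  obtain ⟨m, n, h1, h2⟩ := R_form k hk1 α
  rw [h1] at h
  obtain ⟨rfl, rfl⟩ := int_lin_zero (irr_omg k hk hk1).1 h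
  apply Subtype.ext
  apply Prod.ext <;> simp [h1, h2]

lemma R_snd_zero (hk : Squarefree k) (hk1 : 1 < k) {α : R k} (h : (α : ℝ × ℝ).2 = 0) : α = 0 := by
  obtain ⟨m, n, h1, h2⟩ := R_form k hk1 α
  rw [h2] at h
  obtain ⟨rfl, rfl⟩ := int_lin_zero (irr_omg k hk hk1).2 h
  apply Subtype.ext
  apply Prod.ext <;> simp [h1, h2]

lemma R_norm_int (hk1 : 1 < k) (α : R k) : ∃ z : ℤ, (α : ℝ × ℝ).1 * (α : ℝ × ℝ).2 = z := by
  obtain ⟨s, t, hs, ht⟩ := omg_quad k hk1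
  obtain ⟨m, n, h1, h2⟩ := R_form k hk1 α
  refine ⟨m ^ 2 + m * n * s - n ^ 2 * t, ?_⟩
  rw [h1, h2]; push_cast
  linear_combination (m * n : ℝ) * hs + (n ^ 2 : ℝ) * ht

lemma R_norm_ge (hk : Squarefree k) (hk1 : 1 < k) {α : R k} (h : α ≠ 0) :
    1 ≤ ((α : ℝ × ℝ).1 * (α : ℝ × ℝ).2) ^ 2 := by
  obtain ⟨z, hz⟩ := R_norm_int hk1 α
  have hz0 : z ≠ 0 := by
    rintro rfl
    rw [Int.cast_zero, mul_eq_zero] at hz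
    rcases hz with hz | hz
    · exact h (R_fst_zero hk hk1 hz)
    · exact h (R_snd_zero hk hk1 hz)
  rw [hz]
  have : 1 ≤ z ^ 2 := by have : 0 < z ^ 2 := by positivity
                         omega
  exact_mod_cast this

lemma R_unit_norm (hk : Squarefree k) (hk1 : 1 < k) {α β : R k} (h : α * β = 1) :
    ((α : ℝ × ℝ).1 * (α : ℝ × ℝ).2) ^ 2 = 1 := by
  have ha : α ≠ 0 := by rintro rfl; simp at h
  have hb : β ≠ 0 := by rintro rfl; simp at h
  have h1 := R_norm_ge hk hk1 ha
  have h2 := R_norm_ge hk hk1 hb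
  have h3 : ((α * β : R k) : ℝ × ℝ) = 1 := by rw [h]; rfl
  have h4 : (α : ℝ × ℝ).1 * (β : ℝ × ℝ).1 = 1 := congrArg Prod.fst h3
  have h5 : (α : ℝ × ℝ).2 * (β : ℝ × ℝ).2 = 1 := congrArg Prod.snd h3
  have h6 : ((α : ℝ × ℝ).1 * (α : ℝ × ℝ).2) ^ 2 * ((β : ℝ × ℝ).1 * (β : ℝ × ℝ).2) ^ 2 = 1 := by
    calc _ = (((α : ℝ × ℝ).1 * (β : ℝ × ℝ).1) * ((α : ℝ × ℝ).2 * (β : ℝ × ℝ).2)) ^ 2 := by ring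
      _ = 1 := by rw [h4, h5]; norm_num
  nlinarith

lemma R_box_finite (hk1 : 1 < k) (B : ℝ) :
    {α : R k | |(α : ℝ × ℝ).1| ≤ B ∧ |(α : ℝ × ℝ).2| ≤ B}.Finite := by
  have hd := omg_sub_pos k hk1
  set N := ⌈2 * B / (omg k - omg' k)⌉ with hN
  set M := ⌈B + |(N : ℝ)| * |omg k|⌉ with hM
  let f : ℤ × ℤ → ℝ × ℝ := fun q => (q.1 + q.2 * omg k, q.1 + q.2 * omg' k)
  have hfin : (f '' (Set.Icc (-M) M ×ˢ Set.Icc (-N) N)).Finite :=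
    ((Set.finite_Icc _ _).prod (Set.finite_Icc _ _)).image f
  refine (hfin.preimage (f := fun α : R k => (α : ℝ × ℝ)) Subtype.val_injective.injOn).subset ?_
  rintro α ⟨h1, h2⟩
  obtain ⟨m, n, e1, e2⟩ := R_form k hk1 α
  refine ⟨(m, n), ?_, Prod.ext e1.symm e2.symm⟩
  have hn : |(n : ℝ)| ≤ N := by
    refine le_trans ?_ (Int.le_ceil _)
    rw [le_div_iff₀ hd]
    have : (n : ℝ) * (omg k - omg' k) = (α : ℝ × ℝ).1 - (α : ℝ × ℝ).2 := by rw [e1, e2]; ring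
    calc |(n : ℝ)| * (omg k - omg' k) = |(n : ℝ) * (omg k - omg' k)| := by
          rw [abs_mul, abs_of_pos hd]
      _ ≤ |(α : ℝ × ℝ).1| + |(α : ℝ × ℝ).2| := by rw [this]; exact abs_sub _ _
      _ ≤ 2 * B := by linarith
  have hm : |(m : ℝ)| ≤ M := by
    refine le_trans ?_ (Int.le_ceil _)
    have : (m : ℝ) = (α : ℝ × ℝ).1 - n * omg k := by rw [e1]; ring
    calc |(m : ℝ)| ≤ |(α : ℝ × ℝ).1| + |n * omg k| := by rw [this]; exact abs_sub _ _
      _ ≤ B + |(N : ℝ)| * |omg k| := by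
        rw [abs_mul]
        have hnn : |(n : ℝ)| ≤ |(N : ℝ)| := le_trans hn (le_abs_self _)
        have := mul_le_mul_of_nonneg_right hnn (abs_nonneg (omg k))
        linarith
  have hn' : |n| ≤ N := by exact_mod_cast hn
  have hm' : |m| ≤ M := by exact_mod_cast hm
  exact ⟨abs_le.1 hm', abs_le.1 hn'⟩

lemma R_countable (hk1 : 1 < k) : Countable (R k) := by
  rw [← Set.countable_univ_iff]
  have : (Set.univ : Set (R k)) ⊆
      ⋃ n : ℕ, {α : R k | |(α : ℝ × ℝ).1| ≤ n ∧ |(α : ℝ × ℝ).2| ≤ n} := by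
    intro α _
    obtain ⟨n, hn⟩ := exists_nat_ge (max |(α : ℝ × ℝ).1| |(α : ℝ × ℝ).2|)
    exact Set.mem_iUnion.2 ⟨n, le_trans (le_max_left _ _) hn, le_trans (le_max_right _ _) hn⟩
  exact (Set.countable_iUnion fun n : ℕ => (R_box_finite hk1 n).countable).mono this

end

/-! ### The action -/

/-- `|cz+d|²` -/
def den (c d x y : ℝ) : ℝ := (c * x + d) ^ 2 + c ^ 2 * y ^ 2

lemma den_pos {a b c d x y : ℝ} (h : a * d - b * c = 1) (hy : 0 < y) : 0 < den c d x y := by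
  unfold den
  by_cases hc : c = 0
  · subst hc
    have : d ≠ 0 := by rintro rfl; simp at h
    simp; positivity
  · positivity

lemma moeb_snd (a b c d x y : ℝ) : (moeb a b c d x y).2 = y / den c d x y := rfl

lemma moeb_cocycle {a b c d x y : ℝ} (h : a * d - b * c = 1) (hy : 0 < y) (p q : ℝ) :
    den p q (moeb a b c d x y).1 (moeb a b c d x y).2 * den c d x y =
      den (p * a + q * c) (p * b + q * d) x y := by
  have hD := den_pos (x := x) h hy
  simp only [moeb]
  have e : (c * x + d) ^ 2 + c ^ 2 * y ^ 2 = den c d x y := rfl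
  rw [e]
  have hne := hD.ne'
  set D := den c d x y with hDd
  simp only [den]
  field_simp
  rw [hDd]
  simp only [den]
  have hd : (a * d - b * c)^2 = 1 := by rw [h]; norm_num
  linear_combination (-(p^2 * y^2)) * hd

lemma moeb_normSq {a b c d x y : ℝ} (h : a * d - b * c = 1) (hy : 0 < y) :
    ((moeb a b c d x y).1 ^ 2 + (moeb a b c d x y).2 ^ 2) * den c d x y = den a b x y := by
  have := moeb_cocycle (x := x) h hy 1 0
  simp only [den] at this ⊢
  linear_combination this

lemma moeb_comp {a b c d a' b' c' d' x y : ℝ} (h : a * d - b * c = 1) (h' : a' * d' - b' * c' = 1)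
    (hy : 0 < y) :
    moeb a b c d (moeb a' b' c' d' x y).1 (moeb a' b' c' d' x y).2 =
      moeb (a * a' + b * c') (a * b' + b * d') (c * a' + d * c') (c * b' + d * d') x y := by
  have hD := den_pos (x := x) h' hy
  have hco := moeb_cocycle (x := x) h' hy c d
  have hE : 0 < den (c * a' + d * c') (c * b' + d * d') x y := by
    refine den_pos (a := a * a' + b * c') (b := a * b' + b * d') ?_ hy
    linear_combination (a' * d' - b' * c') * h + h'
  have hF : 0 < den c d (moeb a' b' c' d' x y).1 (moeb a' b' c' d' x y).2 := by
    rw [← hco] at hE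
    exact pos_of_mul_pos_left hE hD.le
  have hFe : den c d (moeb a' b' c' d' x y).1 (moeb a' b' c' d' x y).2 =
    den (c * a' + d * c') (c * b' + d * d') x y / den c' d' x y := by
    rw [← hco]; field_simp
  have e2 : (moeb a' b' c' d' x y).2 = y / den c' d' x y := rfl
  apply Prod.ext
  · have key : ((a * (moeb a' b' c' d' x y).1 + b) * (c * (moeb a' b' c' d' x y).1 + d)
        + a * c * (moeb a' b' c' d' x y).2 ^ 2) * den c' d' x y =
        (((a * a' + b * c') * x + (a * b' + b * d')) * ((c * a' + d * c') * x + (c * b' + d * d'))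
          + (a * a' + b * c') * (c * a' + d * c') * y ^ 2) := by
      have n := moeb_normSq (x := x) h' hy
      have f1 : (moeb a' b' c' d' x y).1 * den c' d' x y =
        (a' * x + b') * (c' * x + d') + a' * c' * y ^ 2 := by
        have : (moeb a' b' c' d' x y).1 =
          ((a' * x + b') * (c' * x + d') + a' * c' * y ^ 2) / den c' d' x y := rfl
        rw [this]; field_simp
      have f2 : den c' d' x y = (c' * x + d') ^ 2 + c' ^ 2 * y ^ 2 := rfl
      have f3 : den a' b' x y = (a' * x + b') ^ 2 + a' ^ 2 * y ^ 2 := rfl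
      rw [f3] at n
      linear_combination (a * c) * n + (a * d + b * c) * f1 + b * d * f2
    have e1 : (moeb a b c d (moeb a' b' c' d' x y).1 (moeb a' b' c' d' x y).2).1 =
      ((a * (moeb a' b' c' d' x y).1 + b) * (c * (moeb a' b' c' d' x y).1 + d)
        + a * c * (moeb a' b' c' d' x y).2 ^ 2) /
        den c d (moeb a' b' c' d' x y).1 (moeb a' b' c' d' x y).2 := rfl
    have e3 : (moeb (a * a' + b * c') (a * b' + b * d') (c * a' + d * c') (c * b' + d * d') x y).1 =
      (((a * a' + b * c') * x + (a * b' + b * d')) * ((c * a' + d * c') * x + (c * b' + d * d'))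
          + (a * a' + b * c') * (c * a' + d * c') * y ^ 2) /
        den (c * a' + d * c') (c * b' + d * d') x y := rfl
    rw [e1, e3, ← key, hFe]
    field_simp
  · rw [moeb_snd, hFe, moeb_snd, moeb_snd]
    field_simp

section
variable {k : ℕ}

lemma det1 (g : SL k) : (g.1 0 0 : ℝ × ℝ).1 * (g.1 1 1 : ℝ × ℝ).1 -
    (g.1 0 1 : ℝ × ℝ).1 * (g.1 1 0 : ℝ × ℝ).1 = 1 := by
  have h := g.2
  rw [Matrix.det_fin_two] at h
  exact congrArg (fun z : R k => (z : ℝ × ℝ).1) h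

lemma det2 (g : SL k) : (g.1 0 0 : ℝ × ℝ).2 * (g.1 1 1 : ℝ × ℝ).2 -
    (g.1 0 1 : ℝ × ℝ).2 * (g.1 1 0 : ℝ × ℝ).2 = 1 := by
  have h := g.2
  rw [Matrix.det_fin_two] at h
  exact congrArg (fun z : R k => (z : ℝ × ℝ).2) h

def D1 (g : SL k) (p : Pt) : ℝ := den (g.1 1 0 : ℝ × ℝ).1 (g.1 1 1 : ℝ × ℝ).1 (x1 p) (y1 p)
def D2 (g : SL k) (p : Pt) : ℝ := den (g.1 1 0 : ℝ × ℝ).2 (g.1 1 1 : ℝ × ℝ).2 (x2 p) (y2 p)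
def NN (g : SL k) (p : Pt) : ℝ := D1 g p * D2 g p

lemma NN_eq (g : SL k) (p : Pt) :
    NN g p = HNorm (g.1 1 0 : ℝ × ℝ) (g.1 1 1 : ℝ × ℝ) p := rfl

lemma D1_pos (g : SL k) {p : Pt} (hp : p ∈ HH) : 0 < D1 g p := den_pos (det1 g) hp.1
lemma D2_pos (g : SL k) {p : Pt} (hp : p ∈ HH) : 0 < D2 g p := den_pos (det2 g) hp.2
lemma NN_pos (g : SL k) {p : Pt} (hp : p ∈ HH) : 0 < NN g p := mul_pos (D1_pos g hp) (D2_pos g hp)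

lemma y1_act (g : SL k) (p : Pt) : y1 (act k g p) = y1 p / D1 g p := rfl
lemma y2_act (g : SL k) (p : Pt) : y2 (act k g p) = y2 p / D2 g p := rfl

lemma act_mem (g : SL k) {p : Pt} (hp : p ∈ HH) : act k g p ∈ HH :=
  ⟨by rw [y1_act]; exact div_pos hp.1 (D1_pos g hp), by rw [y2_act]; exact div_pos hp.2 (D2_pos g hp)⟩

lemma mul_entry (g h : SL k) (i j : Fin 2) :
    (g * h).1 i j = g.1 i 0 * h.1 0 j + g.1 i 1 * h.1 1 j := by
  rw [Matrix.SpecialLinearGroup.coe_mul, Matrix.mul_apply, Fin.sum_univ_two]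

lemma act_mul (g h : SL k) {p : Pt} (hp : p ∈ HH) : act k (g * h) p = act k g (act k h p) := by
  have e1 := moeb_comp (x := x1 p) (det1 g) (det1 h) hp.1
  have e2 := moeb_comp (x := x2 p) (det2 g) (det2 h) hp.2
  unfold act
  simp only [mul_entry]
  refine Prod.ext ?_ (Prod.ext ?_ (Prod.ext ?_ ?_))
  · exact (congrArg Prod.fst e1).symm
  · exact (congrArg Prod.fst e2).symm
  · exact (congrArg Prod.snd e1).symm
  · exact (congrArg Prod.snd e2).symm

lemma NN_mul (g h : SL k) {p : Pt} (hp : p ∈ HH) : NN (g * h) p = NN g (act k h p) * NN h p := by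
  have e1 := moeb_cocycle (x := x1 p) (det1 h) hp.1 (g.1 1 0 : ℝ × ℝ).1 (g.1 1 1 : ℝ × ℝ).1
  have e2 := moeb_cocycle (x := x2 p) (det2 h) hp.2 (g.1 1 0 : ℝ × ℝ).2 (g.1 1 1 : ℝ × ℝ).2
  have f1 : D1 (g * h) p = D1 g (act k h p) * D1 h p := by
    refine Eq.trans ?_ e1.symm
    simp only [D1, mul_entry]; rfl
  have f2 : D2 (g * h) p = D2 g (act k h p) * D2 h p := by
    refine Eq.trans ?_ e2.symm
    simp only [D2, mul_entry]; rfl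
  simp only [NN, f1, f2]; ring

lemma act_one (p : Pt) : act k 1 p = p := by
  unfold act
  simp [moeb, x1, x2, y1, y2]

lemma NN_one (p : Pt) : NN (1 : SL k) p = 1 := by
  simp [NN, D1, D2, den]

lemma act_inv_act (g : SL k) {p : Pt} (hp : p ∈ HH) : act k g⁻¹ (act k g p) = p := by
  rw [← act_mul _ _ hp, inv_mul_cancel, act_one]

lemma act_act_inv (g : SL k) {p : Pt} (hp : p ∈ HH) : act k g (act k g⁻¹ p) = p := by
  rw [← act_mul _ _ hp, mul_inv_cancel, act_one]

lemma mem_F0_iff (p : Pt) : p ∈ F0 k ↔ p ∈ HH ∧ ∀ g : SL k, 1 ≤ NN g p := by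
  constructor
  · rintro ⟨h1, h2⟩
    refine ⟨h1, fun g => h2 (g.1 1 0, g.1 1 1) ?_⟩
    show Ideal.span {_, _} = ⊤
    rw [Ideal.eq_top_iff_one, Ideal.mem_span_pair]
    refine ⟨-g.1 0 1, g.1 0 0, ?_⟩
    have h := g.2
    rw [Matrix.det_fin_two] at h
    linear_combination h
  · rintro ⟨h1, h2⟩
    refine ⟨h1, ?_⟩
    rintro ⟨c, d⟩ hcd
    have hcd : Ideal.span {c, d} = ⊤ := hcd
    rw [Ideal.eq_top_iff_one, Ideal.mem_span_pair] at hcd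
    obtain ⟨a, b, hab⟩ := hcd
    have := h2 ⟨!![b, -a; c, d], by rw [Matrix.det_fin_two_of]; linear_combination hab⟩
    exact this

lemma NN_inv (g : SL k) {p : Pt} (hp : p ∈ HH) : NN g⁻¹ (act k g p) * NN g p = 1 := by
  rw [← NN_mul _ _ hp, inv_mul_cancel, NN_one]

lemma NN_le_one (g : SL k) {p : Pt} (hp : p ∈ HH) (h : act k g p ∈ F0 k) : NN g p ≤ 1 := by
  have h1 := NN_inv g hp
  have h2 := ((mem_F0_iff _).1 h).2 g⁻¹
  have h3 := NN_pos g hp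
  nlinarith

lemma NN_eq_one (g : SL k) {p : Pt} (hp : p ∈ F0 k) (h : act k g p ∈ F0 k) : NN g p = 1 :=
  le_antisymm (NN_le_one g hp.1 h) (((mem_F0_iff _).1 hp).2 g)

lemma NN_cusp (hk : Squarefree k) (hk1 : 1 < k) (g : SL k) (hg : g.1 1 0 = 0) (p : Pt) :
    NN g p = 1 := by
  have h := g.2
  rw [Matrix.det_fin_two, hg] at h
  have h' : g.1 1 1 * g.1 0 0 = 1 := by linear_combination h
  have := R_unit_norm hk hk1 h'
  simp [NN, D1, D2, den, hg]
  linear_combination this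
end


/-! ### Reduction theory -/

section
variable {k : ℕ}

def phi1 (k : ℕ) : R k →+* ℝ := (RingHom.fst ℝ ℝ).comp (R k).subtype

lemma phi1_apply (α : R k) : phi1 k α = (α : ℝ × ℝ).1 := rfl

lemma unit_zpow_fst (e : (R k)ˣ) (n : ℤ) : (((e ^ n : (R k)ˣ) : R k) : ℝ × ℝ).1 = (eps k e) ^ n := by
  have : Units.map (phi1 k : R k →* ℝ) (e ^ n) = (Units.map (phi1 k : R k →* ℝ) e) ^ n :=
    map_zpow _ _ _
  have h2 := congrArg (fun u : ℝˣ => (u : ℝ)) this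
  simp only [Units.val_zpow_eq_zpow_val] at h2
  exact h2

/-- diagonal element -/
def dg (u : (R k)ˣ) : SL k :=
  ⟨!![((u⁻¹ : (R k)ˣ) : R k), 0; 0, (u : R k)], by rw [Matrix.det_fin_two_of]; simp⟩

/-- translation element -/
def tr (α : R k) : SL k := ⟨!![1, α; 0, 1], by rw [Matrix.det_fin_two_of]; simp⟩

lemma rr_act (g : SL k) {p : Pt} (hp : p ∈ HH) :
    rr (act k g p) = rr p * (D2 g p / D1 g p) := by
  have := D1_pos g hp
  have := D2_pos g hp
  have := hp.2
  unfold rr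
  rw [y1_act, y2_act]
  field_simp

lemma rr_cusp (hk : Squarefree k) (hk1 : 1 < k) (g : SL k) (hg : g.1 1 0 = 0) {p : Pt}
    (hp : p ∈ HH) : rr (act k g p) = rr p / (g.1 1 1 : ℝ × ℝ).1 ^ 4 := by
  have h1 := NN_cusp hk hk1 g hg p
  have h2 := D1_pos g hp
  have h3 : D1 g p = (g.1 1 1 : ℝ × ℝ).1 ^ 2 := by simp [D1, den, hg]
  have h4 : D2 g p = 1 / D1 g p := by
    unfold NN at h1; field_simp; linarith
  rw [rr_act g hp, h4, div_div, ← sq, h3]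
  rw [← pow_mul]
  ring

lemma s_form (hk1 : 1 < k) (p : Pt) :
    x1 p = s1 k p + s2 k p * omg k ∧ x2 p = s1 k p + s2 k p * omg' k := by
  have h := omg_sub_pos k hk1
  have h' : omg' k - omg k ≠ 0 := by linarith
  have h'' : omg k - omg' k ≠ 0 := by linarith
  have e : s1 k p = (omg k * x2 p - omg' k * x1 p) / (omg k - omg' k) := by
    unfold s1
    rw [div_eq_div_iff h' h'']; ring
  rw [e]
  unfold s2
  constructor <;> (field_simp; ring)

lemma s_unique (hk1 : 1 < k) (p : Pt) (a b : ℝ) (h1 : x1 p = a + b * omg k)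
    (h2 : x2 p = a + b * omg' k) : s1 k p = a ∧ s2 k p = b := by
  have h := omg_sub_pos k hk1
  have h' : omg' k - omg k ≠ 0 := by linarith
  have h'' : omg k - omg' k ≠ 0 := by linarith
  unfold s1 s2
  rw [h1, h2]
  constructor <;> (field_simp; ring)

lemma x_tr (α : R k) (p : Pt) : x1 (act k (tr α) p) = x1 p + (α : ℝ × ℝ).1 ∧
    x2 (act k (tr α) p) = x2 p + (α : ℝ × ℝ).2 := by
  constructor <;> simp [act, tr, moeb, x1, x2]

lemma exists_reduce (hk : Squarefree k) (hk1 : 1 < k) (e : (R k)ˣ) (he : IsFundUnit k e)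
    {p : Pt} (hp : p ∈ HH) : ∃ T : SL k, T.1 1 0 = 0 ∧ act k T p ∈ FInf k (eps k e) := by
  have hε : 1 < eps k e := he.1
  set ε := eps k e with hεd
  have hr : 0 < rr p := div_pos hp.1 hp.2
  obtain ⟨n, hn1, hn2⟩ := exists_mem_Ico_zpow (x := rr p * ε ^ 2) (y := ε ^ 4) (by positivity)
    (one_lt_pow₀ hε (by norm_num))
  set q := act k (dg (e ^ n)) p with hq
  have hqH : q ∈ HH := act_mem _ hp
  have hrq : rr q = rr p / (ε ^ 4) ^ n := by
    have := rr_cusp hk hk1 (dg (e ^ n)) (by simp [dg]) hp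
    rw [hq, this]
    have h2 : (((dg (e ^ n)).1 1 1 : R k) : ℝ × ℝ).1 = ε ^ n := by
      have : ((dg (e ^ n)).1 1 1 : R k) = ((e ^ n : (R k)ˣ) : R k) := by simp [dg]
      rw [this, unit_zpow_fst]
    rw [h2, ← zpow_natCast, ← zpow_mul, ← zpow_natCast, ← zpow_mul, mul_comm n]
  have hpn : 0 < (ε ^ 4) ^ n := by positivity
  set m : ℤ := -round (s1 k q)
  set l : ℤ := -round (s2 k q)
  set α : R k := (m : R k) + (l : R k) * omR k with hα
  have hα1 : (α : ℝ × ℝ).1 = m + l * omg k := by simp [hα, omR]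
  have hα2 : (α : ℝ × ℝ).2 = m + l * omg' k := by simp [hα, omR]
  refine ⟨tr α * dg (e ^ n), ?_, ?_⟩
  · rw [mul_entry]; simp [tr, dg]
  · rw [act_mul _ _ hp, ← hq]
    have hrt : rr (act k (tr α) q) = rr q := by
      rw [rr_cusp hk hk1 (tr α) (by simp [tr]) hqH]; simp [tr]
    obtain ⟨hx1, hx2⟩ := x_tr α q
    obtain ⟨f1, f2⟩ := s_form hk1 q
    obtain ⟨hs1, hs2⟩ := s_unique hk1 (act k (tr α) q) (s1 k q + m) (s2 k q + l)
      (by rw [hx1, hα1]; linear_combination f1) (by rw [hx2, hα2]; linear_combination f2)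
    refine ⟨act_mem _ hqH, ?_, ?_, ?_, ?_⟩
    · rw [hs1]
      have := abs_sub_round (s1 k q)
      simpa [m, ← sub_eq_add_neg] using this
    · rw [hs2]
      have := abs_sub_round (s2 k q)
      simpa [l, ← sub_eq_add_neg] using this
    · rw [hrt, hrq, le_div_iff₀ hpn, inv_mul_le_iff₀ (by positivity)]
      linarith
    · rw [hrt, hrq, div_le_iff₀ hpn]
      rw [zpow_add_one₀ (by positivity)] at hn2
      have h2 : 0 < ε ^ 2 := by positivity
      have : rr p * ε ^ 2 ≤ (ε ^ 2 * (ε ^ 4) ^ n) * ε ^ 2 := by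
        refine hn2.le.trans (le_of_eq ?_); ring
      exact le_of_mul_le_mul_right this h2

/-- The box `|xᵢ| ≤ M`, `M⁻¹ ≤ yᵢ ≤ M`. -/
def Box (M : ℝ) : Set Pt :=
  {p | |x1 p| ≤ M ∧ |x2 p| ≤ M ∧ M⁻¹ ≤ y1 p ∧ y1 p ≤ M ∧ M⁻¹ ≤ y2 p ∧ y2 p ≤ M}

lemma den_bound {M B c d x y : ℝ} (hM : 1 ≤ M) (hB : 0 ≤ B) (hx : |x| ≤ M) (hy : M⁻¹ ≤ y)
    (h : den c d x y ≤ B) : |c| ≤ (B + 1) * (1 + M ^ 2) ∧ |d| ≤ (B + 1) * (1 + M ^ 2) := by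
  unfold den at h
  have hM0 : 0 < M := by linarith
  have hyM : 1 ≤ y * M := by
    rw [inv_le_iff_one_le_mul₀ hM0] at hy; exact hy
  have h1 : (c * y) ^ 2 ≤ (B + 1) ^ 2 := by nlinarith [sq_nonneg (c * x + d)]
  have h2 : (c * x + d) ^ 2 ≤ (B + 1) ^ 2 := by nlinarith [sq_nonneg (c * y)]
  have h1 := abs_le_of_sq_le_sq h1 (by linarith)
  have h2 := abs_le_of_sq_le_sq h2 (by linarith)
  have hc : |c| ≤ (B + 1) * M := by
    have : |c| ≤ |c| * |y * M| := by
      exact le_mul_of_one_le_right (abs_nonneg _) (hyM.trans (le_abs_self _))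
    calc |c| ≤ |c| * |y * M| := this
      _ = |c * y| * M := by rw [abs_mul, abs_mul, abs_of_pos hM0]; ring
      _ ≤ _ := by gcongr
  constructor
  · refine hc.trans ?_
    gcongr
    nlinarith
  · calc |d| = |(c * x + d) - c * x| := by ring_nf
      _ ≤ |c * x + d| + |c * x| := abs_sub _ _
      _ ≤ (B + 1) + (B + 1) * M * M := by
        rw [abs_mul]; gcongr
      _ = _ := by ring

lemma NN_lower (hk : Squarefree k) (hk1 : 1 < k) (g : SL k) {p : Pt} (hp : p ∈ HH) :
    NN g p = 1 ∨ (y1 p * y2 p) ^ 2 ≤ NN g p := by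
  by_cases hc : g.1 1 0 = 0
  · exact Or.inl (NN_cusp hk hk1 g hc p)
  · right
    have h := R_norm_ge hk hk1 hc
    set c := ((g.1 1 0 : R k) : ℝ × ℝ)
    have a1 : (c.1 * y1 p) ^ 2 ≤ D1 g p := by
      unfold D1 den; rw [mul_pow]; exact le_add_of_nonneg_left (sq_nonneg _)
    have a2 : (c.2 * y2 p) ^ 2 ≤ D2 g p := by
      unfold D2 den; rw [mul_pow]; exact le_add_of_nonneg_left (sq_nonneg _)
    calc (y1 p * y2 p) ^ 2 ≤ (c.1 * c.2) ^ 2 * (y1 p * y2 p) ^ 2 :=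
          le_mul_of_one_le_left (sq_nonneg _) h
      _ = (c.1 * y1 p) ^ 2 * (c.2 * y2 p) ^ 2 := by ring
      _ ≤ D1 g p * D2 g p := mul_le_mul a1 a2 (sq_nonneg _) (D1_pos g hp).le

lemma D_bounds (hk : Squarefree k) (hk1 : 1 < k) {ε M : ℝ} (hε : 1 < ε) (hM : 1 ≤ M) (g : SL k)
    {p : Pt} (hB : p ∈ Box M) (hF : act k g p ∈ FInf k ε) (hN : NN g p ≤ 1) :
    D1 g p ≤ M ^ 2 * ε ^ 2 ∧ D2 g p ≤ M ^ 2 * ε ^ 2 ∧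
      1 ≤ (M ^ 4 * (M ^ 2 * ε ^ 2) ^ 2) * D1 g p ∧
      1 ≤ (M ^ 4 * (M ^ 2 * ε ^ 2) ^ 2) * D2 g p := by
  obtain ⟨hx1, hx2, hl1, hu1, hl2, hu2⟩ := hB
  have hM0 : 0 < M := by linarith
  have hMi : 0 < M⁻¹ := by positivity
  have hp : p ∈ HH := ⟨by linarith, by linarith⟩
  rw [inv_le_iff_one_le_mul₀ hM0] at hl1 hl2
  obtain ⟨_, _, _, hr1, hr2⟩ := hF
  have d1 := D1_pos g hp
  have d2 := D2_pos g hp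
  have hy1 : 0 < y1 p := hp.1
  have hy2 : 0 < y2 p := hp.2
  rw [rr_act g hp] at hr1 hr2
  have hlow := NN_lower hk hk1 g hp
  unfold NN at hN hlow
  unfold rr at hr1 hr2
  set A := D1 g p
  set B := D2 g p
  set u := y1 p
  set v := y2 p
  set K := M ^ 2 * ε ^ 2 with hK
  have hε2 : 1 ≤ ε ^ 2 := one_le_pow₀ hε.le
  have hM2 : 1 ≤ M ^ 2 := one_le_pow₀ hM
  have hK1 : 1 ≤ K := by nlinarith
  have e1 : u / v * (B / A) = (u * B) / (v * A) := by field_simp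
  rw [e1] at hr1 hr2
  rw [inv_le_iff_one_le_mul₀ (by positivity), div_mul_eq_mul_div, le_div_iff₀ (by positivity)] at hr1
  rw [div_le_iff₀ (by positivity)] at hr2
  have huv1 : u ≤ M ^ 2 * v := by nlinarith
  have huv2 : v ≤ M ^ 2 * u := by nlinarith
  have k1 : A ≤ K * B := by
    have : v * A ≤ v * (K * B) := by
      calc v * A ≤ u * B * ε ^ 2 := by linarith
        _ ≤ (M ^ 2 * v) * B * ε ^ 2 := by gcongr
        _ = _ := by rw [hK]; ring
    exact le_of_mul_le_mul_left this hy2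
  have k2 : B ≤ K * A := by
    have : u * B ≤ u * (K * A) := by
      calc u * B ≤ ε ^ 2 * (v * A) := hr2
        _ ≤ ε ^ 2 * ((M ^ 2 * u) * A) := by gcongr
        _ = _ := by rw [hK]; ring
    exact le_of_mul_le_mul_left this hy1
  have hA : A ≤ K := by
    have : A ^ 2 ≤ K ^ 2 := by nlinarith
    nlinarith
  have hB' : B ≤ K := by
    have : B ^ 2 ≤ K ^ 2 := by nlinarith
    nlinarith
  have hM4 : 1 ≤ M ^ 4 := one_le_pow₀ hM
  have hlow' : 1 ≤ M ^ 4 * (A * B) := by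
    rcases hlow with h | h
    · rw [h]; linarith
    · have h1 : 1 ≤ (u * M) * (v * M) := one_le_mul_of_one_le_of_one_le hl1 hl2
      have h2 : 1 ≤ ((u * M) * (v * M)) ^ 2 := one_le_pow₀ h1
      calc (1:ℝ) ≤ ((u * M) * (v * M)) ^ 2 := h2
        _ = M ^ 4 * (u * v) ^ 2 := by ring
        _ ≤ _ := by gcongr
  refine ⟨hA, hB', ?_, ?_⟩
  · calc (1:ℝ) ≤ M ^ 4 * (A * B) := hlow'
      _ ≤ M ^ 4 * (A * (K * K)) := by gcongr; nlinarith
      _ = _ := by ring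
  · calc (1:ℝ) ≤ M ^ 4 * (A * B) := hlow'
      _ ≤ M ^ 4 * ((K * K) * B) := by gcongr; nlinarith
      _ = _ := by ring

lemma entry_bound {M K L O a b c d x y : ℝ} (hM : 1 ≤ M)
    (hdet : a * d - b * c = 1)
    (hy : M⁻¹ ≤ y) (hy2 : y ≤ M) (h : den c d x y ≤ K) (h' : 1 ≤ L * den c d x y)
    (hX : |(moeb a b c d x y).1| ≤ O) :
    den a b x y ≤ (O ^ 2 + (M * L) ^ 2) * K := by
  have hM0 : 0 < M := by linarith
  have hy0 : 0 < y := lt_of_lt_of_le (by positivity) hy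
  have hD := den_pos (x := x) hdet hy0
  rw [← moeb_normSq hdet hy0]
  have hY : (moeb a b c d x y).2 ≤ M * L := by
    rw [moeb_snd, div_le_iff₀ hD]
    calc y ≤ M := hy2
      _ ≤ M * (L * den c d x y) := le_mul_of_one_le_right hM0.le h'
      _ = _ := by ring
  have hY0 : 0 ≤ (moeb a b c d x y).2 := by rw [moeb_snd]; positivity
  have h1 : (moeb a b c d x y).1 ^ 2 ≤ O ^ 2 := sq_le_sq' (abs_le.1 hX).1 (abs_le.1 hX).2
  gcongr

lemma locally_finite (hk : Squarefree k) (hk1 : 1 < k) {ε M : ℝ} (hε : 1 < ε) (hM : 1 ≤ M) :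
    {g : SL k | ∃ p ∈ Box M, act k g p ∈ FInf k ε ∧ NN g p ≤ 1}.Finite := by
  set K := M ^ 2 * ε ^ 2 with hK
  set L := M ^ 4 * K ^ 2 with hL
  set O := 1 + |omg k| + |omg' k| with hO
  set B := K + (O ^ 2 + (M * L) ^ 2) * K with hB
  have hM0 : 0 < M := by linarith
  have hε0 : 0 < ε := by linarith
  have hK0 : 0 ≤ K := by positivity
  have hL0 : 0 ≤ L := by positivity
  have hO0 : 0 ≤ O := by positivity
  have hB0 : 0 ≤ B := by positivity
  set B' := (B + 1) * (1 + M ^ 2) with hB'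
  have hfin := R_box_finite hk1 B'
  set Φ := {α : R k | |(α : ℝ × ℝ).1| ≤ B' ∧ |(α : ℝ × ℝ).2| ≤ B'}
  have h2 : (Set.pi Set.univ fun _ : Fin 2 => Set.pi Set.univ fun _ : Fin 2 => Φ).Finite :=
    Set.Finite.pi fun _ => Set.Finite.pi fun _ => hfin
  refine (Set.Finite.preimage (f := fun g : SL k => (g.1 : Fin 2 → Fin 2 → R k))
    (Set.injOn_of_injective fun a b h => Subtype.ext h) h2).subset ?_
  rintro g ⟨p, hp, hF, hN⟩
  obtain ⟨b1, b2, b3, b4⟩ := D_bounds hk hk1 hε hM g hp hF hN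
  obtain ⟨hx1, hx2, hl1, hu1, hl2, hu2⟩ := hp
  obtain ⟨hH, hs1, hs2, _, _⟩ := hF
  obtain ⟨f1, f2⟩ := s_form hk1 (act k g p)
  have X1 : |x1 (act k g p)| ≤ O := by
    rw [f1]
    calc _ ≤ |s1 k (act k g p)| + |s2 k (act k g p)| * |omg k| := by
          rw [← abs_mul]; exact abs_add_le _ _
      _ ≤ 1 / 2 + 1 / 2 * |omg k| := by gcongr
      _ ≤ O := by have := abs_nonneg (omg k); have := abs_nonneg (omg' k); rw [hO]; linarith
  have X2 : |x2 (act k g p)| ≤ O := by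
    rw [f2]
    calc _ ≤ |s1 k (act k g p)| + |s2 k (act k g p)| * |omg' k| := by
          rw [← abs_mul]; exact abs_add_le _ _
      _ ≤ 1 / 2 + 1 / 2 * |omg' k| := by gcongr
      _ ≤ O := by have := abs_nonneg (omg k); have := abs_nonneg (omg' k); rw [hO]; linarith
  have E1 := entry_bound hM (det1 g) hl1 hu1 b1 b3 X1
  have E2 := entry_bound hM (det2 g) hl2 hu2 b2 b4 X2
  have hKB : K ≤ B := by rw [hB]; exact le_add_of_nonneg_right (by positivity)
  have hKB2 : (O ^ 2 + (M * L) ^ 2) * K ≤ B := by rw [hB]; exact le_add_of_nonneg_left hK0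
  obtain ⟨c1, d1⟩ := den_bound hM hB0 hx1 hl1 (le_trans b1 hKB)
  obtain ⟨c2, d2⟩ := den_bound hM hB0 hx2 hl2 (le_trans b2 hKB)
  obtain ⟨a1, b1⟩ := den_bound hM hB0 hx1 hl1 (le_trans E1 hKB2)
  obtain ⟨a2, b2⟩ := den_bound hM hB0 hx2 hl2 (le_trans E2 hKB2)
  suffices hent : ∀ i j, g.1 i j ∈ Φ by
    exact fun i _ j _ => hent i j
  intro i j
  fin_cases i <;> fin_cases j
  · exact ⟨a1, a2⟩
  · exact ⟨b1, b2⟩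
  · exact ⟨c1, c2⟩
  · exact ⟨d1, d2⟩

lemma exists_box {p : Pt} (hp : p ∈ HH) : ∃ M : ℝ, 1 ≤ M ∧ Box M ∈ nhds p := by
  have hy1 : 0 < y1 p := hp.1
  have hy2 : 0 < y2 p := hp.2
  have c1 : Continuous x1 := by unfold x1; fun_prop
  have c2 : Continuous x2 := by unfold x2; fun_prop
  have c3 : Continuous y1 := by unfold y1; fun_prop
  have c4 : Continuous y2 := by unfold y2; fun_prop
  set M := 1 + |x1 p| + |x2 p| + y1 p + y2 p + (y1 p)⁻¹ + (y2 p)⁻¹ with hM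
  have := abs_nonneg (x1 p)
  have := abs_nonneg (x2 p)
  have i1 : 0 < (y1 p)⁻¹ := by positivity
  have i2 : 0 < (y2 p)⁻¹ := by positivity
  have hMp : 0 < M := by linarith
  refine ⟨M, by linarith, ?_⟩
  have m1 : M⁻¹ < y1 p := by rw [inv_lt_comm₀ hMp hy1]; linarith
  have m2 : M⁻¹ < y2 p := by rw [inv_lt_comm₀ hMp hy2]; linarith
  filter_upwards [(c1.abs.tendsto p).eventually_lt_const (show |x1 p| < M by linarith),
    (c2.abs.tendsto p).eventually_lt_const (show |x2 p| < M by linarith),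
    (c3.tendsto p).eventually_const_lt m1, (c3.tendsto p).eventually_lt_const (show y1 p < M by linarith),
    (c4.tendsto p).eventually_const_lt m2, (c4.tendsto p).eventually_lt_const (show y2 p < M by linarith)]
    with q h1 h2 h3 h4 h5 h6
  exact ⟨h1.le, h2.le, h3.le, h4.le, h5.le, h6.le⟩

lemma exists_act_mem_F (hk : Squarefree k) (hk1 : 1 < k) (e : (R k)ˣ) (he : IsFundUnit k e)
    {p : Pt} (hp : p ∈ HH) : ∃ g : SL k, act k g p ∈ F k (eps k e) := by
  obtain ⟨M, hM, hMp⟩ := exists_box hp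
  have hpM : p ∈ Box M := mem_of_mem_nhds hMp
  have hfin : {g : SL k | act k g p ∈ FInf k (eps k e) ∧ NN g p ≤ 1}.Finite :=
    (locally_finite hk hk1 he.1 hM).subset fun g hg => ⟨p, hpM, hg.1, hg.2⟩
  have hred : ∀ g : SL k, ∃ g' : SL k, act k g' p ∈ FInf k (eps k e) ∧ NN g' p = NN g p := by
    intro g
    obtain ⟨T, hT, hT2⟩ := exists_reduce hk hk1 e he (act_mem g hp)
    refine ⟨T * g, by rwa [act_mul _ _ hp], ?_⟩
    rw [NN_mul _ _ hp, NN_cusp hk hk1 T hT, one_mul]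
  obtain ⟨g1, h11, h12⟩ := hred 1
  rw [NN_one] at h12
  obtain ⟨g, ⟨hg1, hg2⟩, hmin⟩ := Set.exists_min_image _ (fun g => NN g p) hfin ⟨g1, h11, h12.le⟩
  refine ⟨g, hg1, (mem_F0_iff _).2 ⟨act_mem g hp, fun g' => ?_⟩⟩
  have h1 := NN_mul g' g hp
  have h2 := NN_pos g hp
  have h3 : NN g p ≤ NN (g' * g) p := by
    rcases le_or_gt (NN (g' * g) p) 1 with h | h
    · obtain ⟨g2, h21, h22⟩ := hred (g' * g)
      rw [← h22]
      exact hmin g2 ⟨h21, by rw [h22]; exact h⟩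
    · linarith
  rw [h1] at h3
  exact le_of_mul_le_mul_right (by linarith) h2

end


/-! ### Topology and dimension -/

section
variable {k : ℕ}

def TT (k : ℕ) (ε : ℝ) (g : SL k) : Set Pt := {p ∈ HH | act k g p ∈ F k ε}

lemma F_sub_HH {ε : ℝ} {p : Pt} (h : p ∈ F k ε) : p ∈ HH := h.1.1

lemma image_eq (ε : ℝ) (g : SL k) : act k g⁻¹ '' F k ε = TT k ε g := by
  ext p
  constructor
  · rintro ⟨q, hq, rfl⟩
    exact ⟨act_mem _ (F_sub_HH hq), by rwa [act_act_inv g (F_sub_HH hq)]⟩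
  · rintro ⟨hp, hq⟩
    exact ⟨_, hq, act_inv_act g hp⟩

lemma convex_HH : Convex ℝ HH := by
  rintro p ⟨hp1, hp2⟩ q ⟨hq1, hq2⟩ a b ha hb hab
  have key : ∀ u v : ℝ, 0 < u → 0 < v → 0 < a * u + b * v := by
    intro u v hu hv
    rcases ha.eq_or_lt with rfl | ha
    · have : b = 1 := by linarith
      subst this; linarith
    · have := mul_pos ha hu
      have := mul_nonneg hb hv.le
      linarith
  exact ⟨key _ _ hp1 hq1, key _ _ hp2 hq2⟩

lemma isOpen_HH : IsOpen HH := by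
  have c3 : Continuous y1 := by unfold y1; fun_prop
  have c4 : Continuous y2 := by unfold y2; fun_prop
  exact (isOpen_lt continuous_const c3).inter (isOpen_lt continuous_const c4)

lemma contDiffOn_act (g : SL k) : ContDiffOn ℝ 1 (act k g) HH := by
  have h1 : ∀ p ∈ HH, ((g.1 1 0 : ℝ × ℝ).1 * x1 p + (g.1 1 1 : ℝ × ℝ).1) ^ 2 +
      (g.1 1 0 : ℝ × ℝ).1 ^ 2 * y1 p ^ 2 ≠ 0 := fun p hp => (D1_pos g hp).ne'
  have h2 : ∀ p ∈ HH, ((g.1 1 0 : ℝ × ℝ).2 * x2 p + (g.1 1 1 : ℝ × ℝ).2) ^ 2 +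
      (g.1 1 0 : ℝ × ℝ).2 ^ 2 * y2 p ^ 2 ≠ 0 := fun p hp => (D2_pos g hp).ne'
  unfold act moeb
  unfold x1 x2 y1 y2 at *
  refine ContDiffOn.prodMk ?_ (ContDiffOn.prodMk ?_ (ContDiffOn.prodMk ?_ ?_))
  · exact ContDiffOn.div (by fun_prop) (by fun_prop) h1
  · exact ContDiffOn.div (by fun_prop) (by fun_prop) h2
  · exact ContDiffOn.div (by fun_prop) (by fun_prop) h1
  · exact ContDiffOn.div (by fun_prop) (by fun_prop) h2

lemma dimH_act_image (g : SL k) {s : Set Pt} (hs : s ⊆ HH) : dimH (act k g '' s) ≤ dimH s :=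
  (contDiffOn_act g).dimH_image_le convex_HH hs

lemma F_closed (ε : ℝ) : ∃ C : Set Pt, IsClosed C ∧ F k ε = HH ∩ C := by
  refine ⟨{p | |s1 k p| ≤ 1 / 2} ∩ {p | |s2 k p| ≤ 1 / 2} ∩ {p | (ε ^ 2)⁻¹ * y2 p ≤ y1 p} ∩
    {p | y1 p ≤ ε ^ 2 * y2 p} ∩ ⋂ cd ∈ Spairs k,
      {p | 1 ≤ HNorm (cd.1 : ℝ × ℝ) (cd.2 : ℝ × ℝ) p}, ?_, ?_⟩
  · refine IsClosed.inter (IsClosed.inter (IsClosed.inter (IsClosed.inter ?_ ?_) ?_) ?_) ?_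
    · exact isClosed_le (by unfold s1 x1 x2; fun_prop) continuous_const
    · exact isClosed_le (by unfold s2 x1 x2; fun_prop) continuous_const
    · exact isClosed_le (by unfold y2; fun_prop) (by unfold y1; fun_prop)
    · exact isClosed_le (by unfold y1; fun_prop) (by unfold y2; fun_prop)
    · exact isClosed_biInter fun cd _ =>
        isClosed_le continuous_const (by unfold HNorm x1 x2 y1 y2; fun_prop)
  · ext p
    simp only [F, FInf, F0, Set.mem_inter_iff, Set.mem_ofPred_eq, Set.mem_iInter]
    constructor
    · rintro ⟨⟨hp, h1, h2, h3, h4⟩, _, h5⟩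
      have := hp.2
      unfold rr at h3 h4
      rw [le_div_iff₀ this] at h3
      rw [div_le_iff₀ this] at h4
      exact ⟨hp, ⟨⟨⟨h1, h2⟩, h3⟩, h4⟩, h5⟩
    · rintro ⟨hp, ⟨⟨⟨h1, h2⟩, h3⟩, h4⟩, h5⟩
      have := hp.2
      refine ⟨⟨hp, h1, h2, ?_, ?_⟩, hp, h5⟩
      · unfold rr; rwa [le_div_iff₀ this]
      · unfold rr; rwa [div_le_iff₀ this]

lemma isOpen_avoid (hk : Squarefree k) (hk1 : 1 < k) {ε : ℝ} (hε : 1 < ε) (S : Set (SL k)) :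
    IsOpen {p ∈ HH | ∀ g ∈ S, p ∉ TT k ε g} := by
  rw [isOpen_iff_mem_nhds]
  rintro p ⟨hp, hpS⟩
  obtain ⟨M, hM, hMp⟩ := exists_box hp
  obtain ⟨C, hC, hFC⟩ := F_closed (k := k) ε
  have hfin := locally_finite hk hk1 hε hM
  have hH : HH ∈ nhds p := isOpen_HH.mem_nhds hp
  have hev : ∀ g ∈ {g : SL k | ∃ p ∈ Box M, act k g p ∈ FInf k ε ∧ NN g p ≤ 1},
      ∀ᶠ q in nhds p, g ∈ S → q ∉ TT k ε g := by
    intro g _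
    by_cases hg : g ∈ S
    · have h1 := hpS g hg
      have h2 : act k g p ∉ C := fun h => h1 ⟨hp, by rw [hFC]; exact ⟨act_mem g hp, h⟩⟩
      have hc : ContinuousAt (act k g) p := ((contDiffOn_act g).continuousOn).continuousAt hH
      filter_upwards [hc.eventually (hC.isOpen_compl.mem_nhds h2)] with q hq _ hq2
      have := hq2.2
      rw [hFC] at this
      exact hq this.2
    · exact Filter.Eventually.of_forall fun q h => absurd h hg
  have hev' := (Filter.eventually_all_finite hfin).2 hev
  filter_upwards [hev', hMp, hH] with q h1 h2 h3
  refine ⟨h3, fun g hg hq => ?_⟩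
  exact h1 g ⟨q, h2, hq.2.1, NN_le_one g h3 hq.2.2⟩ hg hq

lemma dimH_le_three {s : Set Pt} (φ : ℝ × ℝ × ℝ → Pt)
    (h : ∀ p ∈ s, ∃ q, ContDiffAt ℝ 1 φ q ∧ φ q = p) : dimH s ≤ 3 := by
  have h1 : s ⊆ φ '' {q | ContDiffAt ℝ 1 φ q} := fun p hp => h p hp
  calc dimH s ≤ dimH (φ '' {q | ContDiffAt ℝ 1 φ q}) := dimH_mono h1
    _ ≤ dimH {q | ContDiffAt ℝ 1 φ q} := by
      apply dimH_image_le_of_locally_lipschitzOn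
      intro x hx
      obtain ⟨K, t, ht, hl⟩ := ContDiffAt.exists_lipschitzOnWith hx
      exact ⟨K, t, mem_nhdsWithin_of_mem_nhds ht, hl⟩
    _ ≤ dimH (Set.univ : Set (ℝ × ℝ × ℝ)) := dimH_mono (Set.subset_univ _)
    _ = 3 := by
      rw [Real.dimH_univ_eq_finrank]
      simp

lemma dimH_V (hk : Squarefree k) (hk1 : 1 < k) (g : SL k) (hc : g.1 1 0 ≠ 0) {s : Set Pt}
    (hs : ∀ p ∈ s, p ∈ HH ∧ NN g p = 1) : dimH s ≤ 3 := by
  set c1 := (g.1 1 0 : ℝ × ℝ).1 with hc1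
  set c2 := (g.1 1 0 : ℝ × ℝ).2 with hc2
  set d1 := (g.1 1 1 : ℝ × ℝ).1 with hd1
  set d2 := (g.1 1 1 : ℝ × ℝ).2 with hd2
  have n2 : c2 ≠ 0 := fun h => hc (R_snd_zero hk hk1 h)
  refine dimH_le_three (fun q => (q.1, q.2.1, q.2.2,
    Real.sqrt (1 / ((c1 * q.1 + d1) ^ 2 + c1 ^ 2 * q.2.2 ^ 2) - (c2 * q.2.1 + d2) ^ 2) / |c2|)) ?_
  intro p hp
  obtain ⟨hH, hN⟩ := hs p hp
  have hy2 : 0 < y2 p := hH.2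
  have hD := D1_pos g hH
  have e : 1 / ((c1 * x1 p + d1) ^ 2 + c1 ^ 2 * y1 p ^ 2) - (c2 * x2 p + d2) ^ 2 =
      (|c2| * y2 p) ^ 2 := by
    have h1 : (c1 * x1 p + d1) ^ 2 + c1 ^ 2 * y1 p ^ 2 = D1 g p := rfl
    have h2 : D2 g p = (c2 * x2 p + d2) ^ 2 + c2 ^ 2 * y2 p ^ 2 := rfl
    unfold NN at hN
    have h3 : 1 / D1 g p = D2 g p := by field_simp; linarith
    rw [h1, h3, h2, mul_pow, sq_abs]; ring
  refine ⟨(x1 p, x2 p, y1 p), ?_, ?_⟩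
  · refine ContDiffAt.prodMk (by fun_prop) (ContDiffAt.prodMk (by fun_prop)
      (ContDiffAt.prodMk (by fun_prop) ?_))
    refine ContDiffAt.div_const (ContDiffAt.sqrt (ContDiffAt.sub (ContDiffAt.div contDiffAt_const
      (by fun_prop) ?_) (by fun_prop)) ?_) _
    · exact hD.ne'
    · refine ne_of_eq_of_ne e ?_
      have := abs_pos.2 n2
      positivity
  · simp only
    rw [e, Real.sqrt_sq (by positivity)]
    have := abs_pos.2 n2
    refine Prod.ext rfl (Prod.ext rfl (Prod.ext rfl ?_))
    simp only
    rw [mul_div_cancel_left₀ _ this.ne']; rfl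

lemma dimH_s1 (hk1 : 1 < k) (κ : ℝ) : dimH {p : Pt | s1 k p = κ} ≤ 3 := by
  refine dimH_le_three (fun q => (κ + (q.1 - κ) / omg' k * omg k, q.1, q.2.1, q.2.2)) ?_
  intro p hp
  refine ⟨(x2 p, y1 p, y2 p), by fun_prop, ?_⟩
  obtain ⟨f1, f2⟩ := s_form hk1 p
  have h0 := omg'_ne k hk1
  have hp : s1 k p = κ := hp
  refine Prod.ext ?_ rfl
  show κ + (x2 p - κ) / omg' k * omg k = x1 p
  rw [f1, f2, hp]
  field_simp
  ring

lemma dimH_s2 (hk1 : 1 < k) (κ : ℝ) : dimH {p : Pt | s2 k p = κ} ≤ 3 := by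
  refine dimH_le_three (fun q => (q.1 + κ * (omg k - omg' k), q.1, q.2.1, q.2.2)) ?_
  intro p hp
  refine ⟨(x2 p, y1 p, y2 p), by fun_prop, ?_⟩
  obtain ⟨f1, f2⟩ := s_form hk1 p
  have hp : s2 k p = κ := hp
  refine Prod.ext ?_ rfl
  show x2 p + κ * (omg k - omg' k) = x1 p
  rw [f1, f2, hp]
  ring

lemma dimH_rr (κ : ℝ) : dimH {p : Pt | p ∈ HH ∧ rr p = κ} ≤ 3 := by
  refine dimH_le_three (fun q => (q.1, q.2.1, κ * q.2.2, q.2.2)) ?_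
  rintro p ⟨hp, hr⟩
  refine ⟨(x1 p, x2 p, y2 p), by fun_prop, ?_⟩
  have : y2 p ≠ 0 := hp.2.ne'
  refine Prod.ext rfl (Prod.ext rfl (Prod.ext ?_ rfl))
  show κ * y2 p = y1 p
  rw [← hr, rr]
  field_simp

lemma shift_case {s : ℝ} {m : ℤ} (hm : m ≠ 0) (h1 : |s| ≤ 1 / 2) (h2 : |s + m| ≤ 1 / 2) :
    s = -m / 2 := by
  rw [abs_le] at h1 h2
  rcases lt_or_gt_of_ne hm with h | h
  · have : (m : ℝ) ≤ -1 := by exact_mod_cast (by omega : m ≤ -1)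
    linarith
  · have : (1 : ℝ) ≤ m := by exact_mod_cast (by omega : 1 ≤ m)
    linarith

lemma x_cusp (g : SL k) (hc : g.1 1 0 = 0) (p : Pt)
    (hd : g.1 1 1 * g.1 1 1 = 1) :
    x1 (act k g p) = x1 p + ((g.1 0 1 * g.1 1 1 : R k) : ℝ × ℝ).1 ∧
    x2 (act k g p) = x2 p + ((g.1 0 1 * g.1 1 1 : R k) : ℝ × ℝ).2 := by
  have h := g.2
  rw [Matrix.det_fin_two, hc] at h
  have h' : g.1 0 0 * g.1 1 1 = 1 := by linear_combination h
  have a1 : (g.1 0 0 : ℝ × ℝ).1 * (g.1 1 1 : ℝ × ℝ).1 = 1 :=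
    congrArg (fun z : R k => (z : ℝ × ℝ).1) h'
  have a2 : (g.1 0 0 : ℝ × ℝ).2 * (g.1 1 1 : ℝ × ℝ).2 = 1 :=
    congrArg (fun z : R k => (z : ℝ × ℝ).2) h'
  have b1 : (g.1 1 1 : ℝ × ℝ).1 * (g.1 1 1 : ℝ × ℝ).1 = 1 :=
    congrArg (fun z : R k => (z : ℝ × ℝ).1) hd
  have b2 : (g.1 1 1 : ℝ × ℝ).2 * (g.1 1 1 : ℝ × ℝ).2 = 1 :=
    congrArg (fun z : R k => (z : ℝ × ℝ).2) hd
  constructor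
  · show (moeb _ _ _ _ _ _).1 = _
    simp only [moeb, hc]
    simp only [ZeroMemClass.coe_zero, Prod.fst_zero, zero_mul, zero_add, mul_zero, add_zero, sq, b1, div_one, MulMemClass.coe_mul,
      Prod.fst_mul]
    linear_combination x1 p * a1
  · show (moeb _ _ _ _ _ _).1 = _
    simp only [moeb, hc]
    simp only [ZeroMemClass.coe_zero, Prod.snd_zero, zero_mul, zero_add, mul_zero, add_zero, sq, b2, div_one, MulMemClass.coe_mul,
      Prod.snd_mul]
    linear_combination x2 p * a2

lemma unit_abs_ge {e : (R k)ˣ} (he : IsFundUnit k e) {α β : R k} (hαβ : α * β = 1)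
    (h : 1 < (α : ℝ × ℝ).1 ^ 2) : eps k e ^ 4 ≤ (α : ℝ × ℝ).1 ^ 4 := by
  have hε : 1 < eps k e := he.1
  have : eps k e ≤ |(α : ℝ × ℝ).1| := by
    have h1 : 1 < |(α : ℝ × ℝ).1| := by
      rw [← sq_abs] at h
      nlinarith [abs_nonneg (α : ℝ × ℝ).1]
    rcases le_total 0 (α : ℝ × ℝ).1 with h0 | h0
    · rw [abs_of_nonneg h0] at h1 ⊢
      exact he.2 ⟨α, β, hαβ, by rw [mul_comm]; exact hαβ⟩ h1
    · rw [abs_of_nonpos h0] at h1 ⊢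
      exact he.2 ⟨-α, -β, by rw [neg_mul_neg]; exact hαβ, by rw [neg_mul_neg, mul_comm]; exact hαβ⟩ h1
  calc eps k e ^ 4 ≤ |(α : ℝ × ℝ).1| ^ 4 := by gcongr
    _ = _ := by rw [pow_abs, abs_of_nonneg (by positivity)]

lemma dimH_inter_le (hk : Squarefree k) (hk1 : 1 < k) {e : (R k)ˣ} (he : IsFundUnit k e)
    (g : SL k) (h1 : g ≠ 1) (h2 : g.1 ≠ -1) :
    dimH (F k (eps k e) ∩ TT k (eps k e) g) ≤ 3 := by
  have hε : 1 < eps k e := he.1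
  set ε := eps k e with hεd
  have hε4 : 0 < ε ^ 4 := by positivity
  have hε2 : 0 < ε ^ 2 := by positivity
  by_cases hc : g.1 1 0 = 0
  swap
  · exact dimH_V hk hk1 g hc fun p hp => ⟨hp.2.1, NN_eq_one g hp.1.2 hp.2.2.2⟩
  have hdet := g.2
  rw [Matrix.det_fin_two, hc] at hdet
  have had : g.1 0 0 * g.1 1 1 = 1 := by linear_combination hdet
  have hda : g.1 1 1 * g.1 0 0 = 1 := by linear_combination hdet
  have had1 : (g.1 0 0 : ℝ × ℝ).1 * (g.1 1 1 : ℝ × ℝ).1 = 1 :=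
    congrArg (fun z : R k => (z : ℝ × ℝ).1) had
  rcases lt_trichotomy ((g.1 1 1 : ℝ × ℝ).1 ^ 2) 1 with hd | hd | hd
  · have ha : 1 < (g.1 0 0 : ℝ × ℝ).1 ^ 2 := by
      have h3 : (g.1 0 0 : ℝ × ℝ).1 ^ 2 * (g.1 1 1 : ℝ × ℝ).1 ^ 2 = 1 := by
        rw [← mul_pow, had1, one_pow]
      by_contra hcon
      push Not at hcon
      nlinarith [sq_nonneg (g.1 0 0 : ℝ × ℝ).1, sq_nonneg (g.1 1 1 : ℝ × ℝ).1]
    have h4 := unit_abs_ge he had ha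
    refine (dimH_mono ?_).trans (dimH_rr (ε ^ 2)⁻¹)
    rintro p ⟨hp, hpH, hp2⟩
    refine ⟨hpH, le_antisymm ?_ hp.1.2.2.2.1⟩
    have h5 := hp2.1.2.2.2.2
    have hd0 : (g.1 1 1 : ℝ × ℝ).1 ≠ 0 := by intro h; rw [h] at had1; simp at had1
    have h6 : rr (act k g p) = rr p * (g.1 0 0 : ℝ × ℝ).1 ^ 4 := by
      rw [rr_cusp hk hk1 g hc hpH, div_eq_iff (by positivity), mul_assoc, ← mul_pow, had1]; simp
    rw [h6] at h5
    have hr : 0 < rr p := div_pos hpH.1 hpH.2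
    have h7 : rr p * ε ^ 4 ≤ ε ^ 2 := (mul_le_mul_of_nonneg_left h4 hr.le).trans h5
    rw [le_inv_comm₀ hr hε2, le_inv_comm₀ hε2 hr, ← one_div, le_div_iff₀ hε2]
    have : (rr p * ε ^ 2) * ε ^ 2 ≤ 1 * ε ^ 2 := by linarith [show rr p * ε ^ 4 = (rr p * ε ^ 2) * ε ^ 2 by ring]
    exact le_of_mul_le_mul_right this hε2
  · have hdd : g.1 1 1 * g.1 1 1 = 1 := by
      rw [← sub_eq_zero]
      apply R_fst_zero hk hk1
      simp
      linarith
    set α : R k := g.1 0 1 * g.1 1 1 with hα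
    have hα0 : α ≠ 0 := by
      intro h0
      have hb : g.1 0 1 = 0 := by
        calc g.1 0 1 = α * g.1 1 1 := by rw [hα, mul_assoc, hdd, mul_one]
          _ = 0 := by rw [h0, zero_mul]
      have haeq : g.1 0 0 = g.1 1 1 := by
        calc g.1 0 0 = (g.1 0 0 * g.1 1 1) * g.1 1 1 := by rw [mul_assoc, hdd, mul_one]
          _ = _ := by rw [had, one_mul]
      have hd1 : g.1 1 1 = 1 ∨ g.1 1 1 = -1 := by
        rcases mul_self_eq_one_iff.1 ((sq _).symm.trans hd) with h | h
        · left
          rw [← sub_eq_zero]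
          apply R_fst_zero hk hk1
          simp [h]
        · right
          rw [← sub_eq_zero]
          apply R_fst_zero hk hk1
          simp [h]
      rcases hd1 with h | h
      · apply h1
        apply Subtype.ext
        ext i j : 2
        fin_cases i <;> fin_cases j <;> simp [hb, hc, haeq, h]
      · apply h2
        ext i j : 2
        fin_cases i <;> fin_cases j <;> simp [hb, hc, haeq, h]
    obtain ⟨m, n, e1, e2⟩ := R_form k hk1 α
    have hs : ∀ p, s1 k (act k g p) = s1 k p + m ∧ s2 k (act k g p) = s2 k p + n := by
      intro p
      obtain ⟨hx1, hx2⟩ := x_cusp g hc p hdd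
      obtain ⟨f1, f2⟩ := s_form hk1 p
      refine s_unique hk1 _ _ _ ?_ ?_
      · rw [hx1, ← hα, e1]; linear_combination f1
      · rw [hx2, ← hα, e2]; linear_combination f2
    by_cases hm : m = 0
    · have hn : n ≠ 0 := by
        rintro rfl
        apply hα0
        apply R_fst_zero hk hk1
        rw [e1, hm]; simp
      refine (dimH_mono ?_).trans (dimH_s2 (k := k) hk1 (-n / 2))
      rintro p ⟨hp, hpH, hp2⟩
      have := hp2.1.2.2.1
      rw [(hs p).2] at this
      exact shift_case hn hp.1.2.2.1 this
    · refine (dimH_mono ?_).trans (dimH_s1 (k := k) hk1 (-m / 2))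
      rintro p ⟨hp, hpH, hp2⟩
      have := hp2.1.2.1
      rw [(hs p).1] at this
      exact shift_case hm hp.1.2.1 this
  · have h4 := unit_abs_ge he hda hd
    refine (dimH_mono ?_).trans (dimH_rr (ε ^ 2))
    rintro p ⟨hp, hpH, hp2⟩
    refine ⟨hpH, le_antisymm hp.1.2.2.2.2 ?_⟩
    have h5 := hp2.1.2.2.2.1
    have hd4 : 0 < (g.1 1 1 : ℝ × ℝ).1 ^ 4 := lt_of_lt_of_le hε4 h4
    rw [rr_cusp hk hk1 g hc hpH, le_div_iff₀ hd4, inv_mul_le_iff₀ hε2] at h5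
    have : ε ^ 2 * ε ^ 2 ≤ ε ^ 2 * rr p := by
      calc ε ^ 2 * ε ^ 2 = ε ^ 4 := by ring
        _ ≤ _ := h4.trans h5
    exact le_of_mul_le_mul_left this hε2

end


/-- A set of vanishing three-dimensional Hausdorff measure is avoided by a generic segment. -/
lemma exists_avoiding_shift {A : Set Pt} (hA : Measure.hausdorffMeasure 3 A = 0) {p q : Pt}
    (hpq : p ≠ q) {δ : ℝ} (hδ : 0 < δ) :
    ∃ v : Pt, v ∈ Metric.ball (0 : Pt) δ ∧ ∀ t : ℝ, p + v + t • (q - p) ∉ A := by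
  by_contra! hcon
  have hw : q - p ≠ 0 := sub_ne_zero.2 hpq.symm
  set w := q - p
  have hfr : Module.finrank ℝ (Pt ⧸ Submodule.span ℝ {w}) = Module.finrank ℝ (Fin 3 → ℝ) := by
    have h1 := (Submodule.span ℝ {w}).finrank_quotient_add_finrank
    rw [finrank_span_singleton hw] at h1
    have h2 : Module.finrank ℝ Pt = 4 := by simp [Pt]
    rw [h2] at h1
    rw [Module.finrank_fin_fun]
    omega
  let E := LinearEquiv.ofFinrankEq (Pt ⧸ Submodule.span ℝ {w}) (Fin 3 → ℝ) hfr
  let L : Pt →ₗ[ℝ] (Fin 3 → ℝ) := E.toLinearMap ∘ₗ (Submodule.span ℝ {w}).mkQ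
  have hLs : Function.Surjective L := E.surjective.comp (Submodule.mkQ_surjective _)
  have hLw : L w = 0 := by
    have : (Submodule.span ℝ {w}).mkQ w = 0 := by
      simp [Submodule.mem_span_singleton_self]
    simp only [L, LinearMap.comp_apply, this, map_zero]
  have hopen : IsOpen (L '' Metric.ball p δ) :=
    (L.isOpenMap_of_finiteDimensional hLs) _ Metric.isOpen_ball
  have hsub : L '' Metric.ball p δ ⊆ L '' A := by
    rintro _ ⟨z, hz, rfl⟩
    have hz' : z - p ∈ Metric.ball (0 : Pt) δ := by
      rw [mem_ball_zero_iff, ← dist_eq_norm]; exact hz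
    obtain ⟨t, ht⟩ := hcon _ hz'
    refine ⟨_, ht, ?_⟩
    rw [add_sub_cancel, map_add, map_smul, hLw, smul_zero, add_zero]
  have hLip := (LinearMap.toContinuousLinearMap L).lipschitz
  have h0 : Measure.hausdorffMeasure 3 (L '' A) = 0 := by
    have := hLip.hausdorffMeasure_image_le (d := 3) (by norm_num) A
    rw [hA, mul_zero] at this
    exact nonpos_iff_eq_zero.1 this
  have h1 : Measure.hausdorffMeasure 3 (L '' Metric.ball p δ) = 0 := measure_mono_null hsub h0
  have h2 : (Measure.hausdorffMeasure 3 : Measure (Fin 3 → ℝ)) = volume := by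
    have := hausdorffMeasure_pi_real (ι := Fin 3)
    simpa using this
  rw [h2] at h1
  have hne : (L '' Metric.ball p δ).Nonempty := (Metric.nonempty_ball.2 hδ).image _
  exact (hopen.measure_pos volume hne).ne' h1

section
variable {k : ℕ}

lemma SL_countable (hk1 : 1 < k) : Countable (SL k) := by
  have := R_countable hk1
  have : Countable (Matrix (Fin 2) (Fin 2) (R k)) :=
    inferInstanceAs (Countable (Fin 2 → Fin 2 → R k))
  exact Function.Injective.countable (f := fun g : SL k => g.1) Subtype.val_injective

lemma TT_inter_sub (ε : ℝ) (g h : SL k) :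
    TT k ε g ∩ TT k ε h ⊆ act k g⁻¹ '' (F k ε ∩ TT k ε (h * g⁻¹)) := by
  rintro p ⟨⟨hp, hg⟩, _, hh⟩
  refine ⟨act k g p, ⟨hg, act_mem g hp, ?_⟩, act_inv_act g hp⟩
  rw [act_mul _ _ (act_mem g hp), act_inv_act g hp]
  exact hh

lemma dimH_TT_gt (hk : Squarefree k) (hk1 : 1 < k) {e : (R k)ˣ} (he : IsFundUnit k e) (g : SL k) :
    ¬ dimH (TT k (eps k e) g) ≤ 3 := by
  intro hle
  have := SL_countable hk1
  have hF : dimH (F k (eps k e)) ≤ 3 := by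
    refine le_trans (dimH_mono ?_) ((dimH_act_image g (s := TT k (eps k e) g) fun p hp => hp.1).trans hle)
    intro p hp
    refine ⟨act k g⁻¹ p, ⟨act_mem _ (F_sub_HH hp), ?_⟩, act_act_inv g (F_sub_HH hp)⟩
    rwa [act_act_inv g (F_sub_HH hp)]
  have hall : ∀ h : SL k, dimH (TT k (eps k e) h) ≤ 3 := by
    intro h
    rw [← image_eq]
    exact (dimH_act_image _ fun p hp => F_sub_HH hp).trans hF
  have hcov : HH ⊆ ⋃ h : SL k, TT k (eps k e) h := by
    intro p hp
    obtain ⟨h, hh⟩ := exists_act_mem_F hk hk1 e he hp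
    exact Set.mem_iUnion.2 ⟨h, hp, hh⟩
  have h3 : dimH HH ≤ 3 := by
    refine (dimH_mono hcov).trans ?_
    rw [dimH_iUnion]
    exact iSup_le hall
  have h4 : dimH HH = 4 := by
    rw [Real.dimH_of_nonempty_interior]
    · simp [Pt]
    · rw [isOpen_HH.interior_eq]
      exact ⟨((0 : ℝ), (0 : ℝ), (1 : ℝ), (1 : ℝ)), by norm_num [y1], by norm_num [y2]⟩
  rw [h4] at h3
  exact absurd h3 (by norm_num)

/-- The subgroup up to sign. -/
def GG (k : ℕ) (ε : ℝ) : Set (SL k) :=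
  {g | ∃ h ∈ Subgroup.closure (SidePairings k ε), g.1 = h.1 ∨ g.1 = -h.1}

lemma GG_mul {ε : ℝ} {g h : SL k} (hg : g ∈ GG k ε) (hh : h ∈ GG k ε) : g * h ∈ GG k ε := by
  obtain ⟨g', hg', hg1⟩ := hg
  obtain ⟨h', hh', hh1⟩ := hh
  refine ⟨g' * h', mul_mem hg' hh', ?_⟩
  rw [Matrix.SpecialLinearGroup.coe_mul, Matrix.SpecialLinearGroup.coe_mul]
  rcases hg1 with a | a <;> rcases hh1 with b | b <;> rw [a, b] <;> simp

end


/-- The group `Γ = PSL₂(R)` is generated by its side-pairing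
transformations, i.e. the `γ ≠ 1` such that `F ∩ γ⁻¹(F)` has Hausdorff dimension `3`.
At the level of `SL₂(R)` this says: every `g` agrees, up to sign, with an element of the
subgroup generated by the side-pairing transformations. -/
theorem generated_by_sidePairings (k : ℕ) (hk : Squarefree k) (hk1 : 1 < k)
    (e : (R k)ˣ) (he : IsFundUnit k e) :
    ∀ g : SL k, ∃ h ∈ Subgroup.closure (SidePairings k (eps k e)),
      g.1 = h.1 ∨ g.1 = -h.1 := by
  intro g₀
  by_contra hg₀
  have hcount := SL_countable hk1
  have hε : 1 < eps k e := he.1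
  have hgg : g₀ ∉ GG k (eps k e) := hg₀
  set ε := eps k e with hεd
  have hone : (1 : SL k) ∈ GG k ε := ⟨1, one_mem _, Or.inl rfl⟩
  -- the intersections are small
  have hsmall : ∀ g ∈ GG k ε, ∀ h ∉ GG k ε, dimH (TT k ε g ∩ TT k ε h) < 3 := by
    intro g hg h hh
    have hγ : h * g⁻¹ ∉ GG k ε := by
      intro hcon
      apply hh
      have := GG_mul hcon hg
      rwa [inv_mul_cancel_right] at this
    have n1 : h * g⁻¹ ≠ 1 := fun h' => hγ (h' ▸ hone)
    have n2 : (h * g⁻¹).1 ≠ -1 := fun h' => hγ ⟨1, one_mem _, Or.inr h'⟩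
    have n3 : h * g⁻¹ ∉ SidePairings k ε := fun h' =>
      hγ ⟨_, Subgroup.subset_closure h', Or.inl rfl⟩
    have n4 : dimH (F k ε ∩ TT k ε (h * g⁻¹)) ≠ 3 := fun h' =>
      n3 ⟨n1, n2, by rw [image_eq]; exact h'⟩
    have n5 := lt_of_le_of_ne (dimH_inter_le hk hk1 he (h * g⁻¹) n1 n2) n4
    refine lt_of_le_of_lt ((dimH_mono (TT_inter_sub ε g h)).trans ?_) n5
    exact dimH_act_image _ fun p hp => F_sub_HH hp.1
  let P : Set (SL k × SL k) := {x | x.1 ∈ GG k ε ∧ x.2 ∉ GG k ε}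
  set A : Set Pt := ⋃ x ∈ P, TT k ε x.1 ∩ TT k ε x.2 with hA
  have hPc : P.Countable := Set.to_countable _
  have hA3 : dimH A ≤ 3 := by
    rw [hA, dimH_bUnion hPc]
    exact iSup₂_le fun x hx => (hsmall _ hx.1 _ hx.2).le
  have hA0 : Measure.hausdorffMeasure 3 A = 0 := by
    rw [hA, measure_biUnion_null_iff hPc]
    intro x hx
    have := hausdorffMeasure_of_dimH_lt (d := 3) (hsmall _ hx.1 _ hx.2)
    simpa using this
  -- the two open sets
  set O1 : Set Pt := {p ∈ HH | ∀ g ∈ (GG k ε)ᶜ, p ∉ TT k ε g} with hO1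
  set O2 : Set Pt := {p ∈ HH | ∀ g ∈ GG k ε, p ∉ TT k ε g} with hO2
  have o1 : IsOpen O1 := isOpen_avoid hk hk1 hε _
  have o2 : IsOpen O2 := isOpen_avoid hk hk1 hε _
  have hcover : ∀ p ∈ HH, ∃ g, p ∈ TT k ε g := by
    intro p hp
    obtain ⟨g, hg⟩ := exists_act_mem_F hk hk1 e he hp
    exact ⟨g, hp, hg⟩
  have hdisj : ∀ p, p ∈ O1 → p ∈ O2 → False := by
    intro p h1 h2
    obtain ⟨g, hg⟩ := hcover p h1.1
    by_cases hgG : g ∈ GG k ε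
    · exact h2.2 g hgG hg
    · exact h1.2 g hgG hg
  have hun : ∀ p ∈ HH, p ∉ A → p ∈ O1 ∨ p ∈ O2 := by
    intro p hp hpA
    by_contra! hcon
    obtain ⟨h1, h2⟩ := hcon
    have h1' : ∃ g ∉ GG k ε, p ∈ TT k ε g := by
      by_contra! h
      exact h1 ⟨hp, h⟩
    have h2' : ∃ g ∈ GG k ε, p ∈ TT k ε g := by
      by_contra! h
      exact h2 ⟨hp, h⟩
    obtain ⟨h, hh, hh'⟩ := h1'
    obtain ⟨g, hg, hg'⟩ := h2'
    exact hpA (Set.mem_biUnion (show (g, h) ∈ P from ⟨hg, hh⟩) ⟨hg', hh'⟩)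
  have ne1 : ∃ p, p ∈ O1 := by
    by_contra! hcon
    refine dimH_TT_gt hk hk1 he (1 : SL k) ((dimH_mono ?_).trans hA3)
    intro p hp
    by_contra hpA
    rcases hun p hp.1 hpA with h | h
    · exact hcon p h
    · exact h.2 1 hone hp
  have ne2 : ∃ p, p ∈ O2 := by
    by_contra! hcon
    refine dimH_TT_gt hk hk1 he g₀ ((dimH_mono ?_).trans hA3)
    intro p hp
    by_contra hpA
    rcases hun p hp.1 hpA with h | h
    · exact h.2 g₀ hgg hp
    · exact hcon p h
  obtain ⟨p, hp⟩ := ne1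
  obtain ⟨q, hq⟩ := ne2
  have hpq : p ≠ q := by
    rintro rfl
    exact hdisj p hp hq
  obtain ⟨δ1, hδ1, hb1⟩ := Metric.isOpen_iff.1 o1 p hp
  obtain ⟨δ2, hδ2, hb2⟩ := Metric.isOpen_iff.1 o2 q hq
  obtain ⟨v, hv, hvA⟩ := exists_avoiding_shift hA0 hpq (lt_min hδ1 hδ2)
  rw [mem_ball_zero_iff, lt_min_iff] at hv
  have hpv : p + v ∈ O1 := hb1 (by rw [Metric.mem_ball, dist_eq_norm, add_sub_cancel_left]; exact hv.1)
  have hqv : q + v ∈ O2 := hb2 (by rw [Metric.mem_ball, dist_eq_norm, add_sub_cancel_left]; exact hv.2)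
  have hseg : segment ℝ (p + v) (q + v) ⊆ HH := convex_HH.segment_subset hpv.1 hqv.1
  have hsegO : segment ℝ (p + v) (q + v) ⊆ O1 ∪ O2 := by
    intro z hz
    have hzH := hseg hz
    rw [segment_eq_image'] at hz
    obtain ⟨t, _, rfl⟩ := hz
    refine hun _ hzH ?_
    have := hvA t
    rwa [show q + v - (p + v) = q - p by abel]
  obtain ⟨z, _, hz1, hz2⟩ := (convex_segment (𝕜 := ℝ) (p + v) (q + v)).isPreconnected O1 O2 o1 o2
    hsegO ⟨p + v, left_mem_segment ℝ _ _, hpv⟩ ⟨q + v, right_mem_segment ℝ _ _, hqv⟩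
  exact hdisj z hz1 hz2


end Hilbert
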